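/- Let p be a prime and n a positive integer. The set of formal power series { f_λ(x) : λ ∈ A_{p,n} } is linearly independent over ℂ, where f_λ(x) = ∏_{j=1}^s (1 − x^{λ_j})^{-1} for λ = (λ_1, …, λ_s); consequently B(p,n) ≥ |A_{p,n}|. -/

import Mathlib

open PowerSeries Finset

/-- `f_λ(x) = ∏ j (1 - x^{λ_j})⁻¹` for a partition `λ`. -/
noncomputable def partitionSeries {n : ℕ} (lam : Nat.Partition n) : PowerSeries ℂ :=
  (lam.parts.map (fun j => (1 - (PowerSeries.X : PowerSeries ℂ) ^ j)⁻¹)).prod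

/-- `A_{p,n}`: the partitions of `n` of the form `(r^a, 1^b)` with `r` a positive integer
coprime to `p` and `a, b ≥ 0`. -/
def Apartitions (p n : ℕ) : Set (Nat.Partition n) :=
  {lam | ∃ r a b : ℕ, 0 < r ∧ Nat.Coprime r p ∧
    lam.parts = Multiset.replicate a r + Multiset.replicate b 1}

/-- `X_p`: the partitions of `n` all of whose parts are coprime to `p`. -/
def XPartitions (p n : ℕ) : Set (Nat.Partition n) :=
  {lam | ∀ j ∈ lam.parts, Nat.Coprime j p}

/-- Quotients of polynomials that are regular and vanish at `z`. -/
def vanishSub (z : ℂ) : Submodule ℂ (PowerSeries ℂ) where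
  carrier := {f | ∃ P Q : Polynomial ℂ, Q.eval z ≠ 0 ∧ P.eval z = 0 ∧
    (Q : PowerSeries ℂ) * f = P}
  zero_mem' := ⟨0, 1, by simp, by simp, by simp⟩
  add_mem' := by
    rintro f g ⟨P, Q, hQ, hP, h⟩ ⟨P', Q', hQ', hP', h'⟩
    refine ⟨Q' * P + Q * P', Q * Q', by simp [hQ, hQ'], by simp [hP, hP'], ?_⟩
    push_cast
    rw [← h, ← h']
    ring
  smul_mem' := by
    rintro c f ⟨P, Q, hQ, hP, h⟩
    refine ⟨c • P, Q, hQ, by simp [hP], ?_⟩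
    rw [Polynomial.coe_smul, ← h, mul_smul_comm]

/-- The denominator polynomial of a multiset. -/
noncomputable def denom (s : Multiset ℕ) : Polynomial ℂ :=
  (s.map (fun j => 1 - (Polynomial.X : Polynomial ℂ) ^ j)).prod

lemma one_sub_mul_inv (j : ℕ) (hj : 0 < j) :
    (1 - (PowerSeries.X : PowerSeries ℂ) ^ j) * (1 - (PowerSeries.X : PowerSeries ℂ) ^ j)⁻¹ = 1 := by
  apply PowerSeries.mul_inv_cancel
  simp [hj.ne']

lemma denom_mul (s : Multiset ℕ) (hs : ∀ j ∈ s, 0 < j) :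
    (denom s : PowerSeries ℂ) *
      (s.map (fun j => (1 - (PowerSeries.X : PowerSeries ℂ) ^ j)⁻¹)).prod = 1 := by
  induction s using Multiset.induction_on with
  | empty => simp [denom]
  | cons a s ih =>
    have h1 := ih (fun j hj => hs j (Multiset.mem_cons_of_mem hj))
    have h2 := one_sub_mul_inv a (hs a (Multiset.mem_cons_self a s))
    have h3 : (denom (a ::ₘ s) : PowerSeries ℂ) = (1 - (PowerSeries.X : PowerSeries ℂ) ^ a) * (denom s : PowerSeries ℂ) := by
      simp [denom]
    rw [h3, Multiset.map_cons, Multiset.prod_cons]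
    calc _ = ((1 - (PowerSeries.X : PowerSeries ℂ) ^ a) * (1 - (PowerSeries.X : PowerSeries ℂ) ^ a)⁻¹) * (denom s * (s.map (fun j => (1 - (PowerSeries.X : PowerSeries ℂ) ^ j)⁻¹)).prod) := by ring
      _ = 1 := by rw [h1, h2, one_mul]

lemma denom_split (s : Multiset ℕ) (r : ℕ) :
    denom s = (1 - Polynomial.X ^ r) ^ (s.count r) * denom (s.filter (fun j => j ≠ r)) := by
  conv_lhs => rw [← Multiset.filter_add_not (fun j => j = r) s]
  rw [denom, Multiset.map_add, Multiset.prod_add, Multiset.filter_eq']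
  simp [denom]

lemma denom_eval_ne (s : Multiset ℕ) (z : ℂ) (h : ∀ j ∈ s, z ^ j ≠ 1) :
    (denom s).eval z ≠ 0 := by
  induction s using Multiset.induction_on with
  | empty => simp [denom]
  | cons a s ih =>
    have h1 := ih (fun j hj => h j (Multiset.mem_cons_of_mem hj))
    have h2 := h a (Multiset.mem_cons_self a s)
    have h3 : denom (a ::ₘ s) = (1 - Polynomial.X ^ a) * denom s := by simp [denom]
    rw [h3, Polynomial.eval_mul]
    refine mul_ne_zero ?_ h1
    simp only [Polynomial.eval_sub, Polynomial.eval_one, Polynomial.eval_pow, Polynomial.eval_X]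
    exact sub_ne_zero.mpr h2.symm

/-- Largest part and its multiplicity. -/
def pkey {n : ℕ} (lam : Nat.Partition n) : ℕ ×ₗ ℕ :=
  toLex (lam.parts.sup, lam.parts.count lam.parts.sup)

lemma rest_ne {n : ℕ} (mu : Nat.Partition n) (r : ℕ) (z : ℂ) (hz : IsPrimitiveRoot z r)
    (h : mu.parts.sup ≤ r) :
    (denom (mu.parts.filter (fun j => j ≠ r))).eval z ≠ 0 := by
  apply denom_eval_ne
  intro j hj
  rw [Multiset.mem_filter] at hj
  have h1 := mu.parts_pos hj.1
  have h2 : j ≤ r := (Multiset.le_sup hj.1).trans h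
  exact hz.pow_ne_one_of_pos_of_lt h1.ne' (lt_of_le_of_ne h2 hj.2)

lemma low_mem {n : ℕ} (mu : Nat.Partition n) (r a : ℕ) (z : ℂ) (hz : IsPrimitiveRoot z r)
    (h : mu.parts.sup ≤ r) (hc : mu.parts.count r < a) :
    (1 - (PowerSeries.X : PowerSeries ℂ) ^ r) ^ a * partitionSeries mu ∈ vanishSub z := by
  refine ⟨(1 - Polynomial.X ^ r) ^ (a - mu.parts.count r), _, rest_ne mu r z hz h, ?_, ?_⟩
  · simp [hz.pow_eq_one]; omega
  · have h1 := denom_mul mu.parts (fun j hj => mu.parts_pos hj)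
    rw [denom_split _ r] at h1
    obtain ⟨d, rfl⟩ : ∃ d, a = mu.parts.count r + d := ⟨a - mu.parts.count r, by omega⟩
    rw [Nat.add_sub_cancel_left]
    push_cast at h1 ⊢
    change _ * partitionSeries mu = 1 at h1
    linear_combination (1 - (PowerSeries.X : PowerSeries ℂ) ^ r) ^ d * h1

lemma top_not_mem {n : ℕ} (mu : Nat.Partition n) (r : ℕ) (z : ℂ) (hz : IsPrimitiveRoot z r)
    (h : mu.parts.sup ≤ r) :
    (1 - (PowerSeries.X : PowerSeries ℂ) ^ r) ^ (mu.parts.count r) * partitionSeries mu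
      ∉ vanishSub z := by
  rintro ⟨P, Q, hQ, hP, he⟩
  have h1 := denom_mul mu.parts (fun j hj => mu.parts_pos hj)
  rw [denom_split _ r] at h1
  change _ * partitionSeries mu = 1 at h1
  have h2 : Q = P * denom (mu.parts.filter (fun j => j ≠ r)) := by
    apply Polynomial.coe_injective ℂ
    push_cast at h1 ⊢
    rw [← he]
    linear_combination (-(Q : PowerSeries ℂ)) * h1
  apply hQ
  rw [h2, Polynomial.eval_mul, hP, zero_mul]

lemma sup_mem {s : Multiset ℕ} (hs : s ≠ 0) : s.sup ∈ s := by
  induction s using Multiset.induction_on with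
  | empty => exact absurd rfl hs
  | cons a s ih =>
    rw [Multiset.sup_cons]
    by_cases h0 : s = 0
    · simp [h0]
    · rcases le_total a s.sup with h | h
      · rw [sup_eq_right.mpr h]; exact Multiset.mem_cons_of_mem (ih h0)
      · rw [sup_eq_left.mpr h]; exact Multiset.mem_cons_self _ _

lemma linInd {n : ℕ} (hn : 0 < n) (A : Set (Nat.Partition n)) (hA : Set.InjOn pkey A) :
    LinearIndependent ℂ (fun lam : A => partitionSeries lam.1) := by
  classical
  rw [linearIndependent_iff']
  intro s c hsum
  by_contra! hcon
  obtain ⟨i, his, hi⟩ := hcon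
  obtain ⟨m, hm, hmax⟩ := (s.filter (fun i => c i ≠ 0)).exists_max_image
    (fun i : A => pkey i.1) ⟨i, by simp [his, hi]⟩
  rw [Finset.mem_filter] at hm
  have hne : m.1.parts ≠ 0 := by
    intro h
    have := m.1.parts_sum
    rw [h] at this
    simp at this
    omega
  set r := m.1.parts.sup with hr
  have hrm : r ∈ m.1.parts := sup_mem hne
  have hrpos : 0 < r := m.1.parts_pos hrm
  have hcpos : 0 < m.1.parts.count r := Multiset.count_pos.mpr hrm
  have hz := Complex.isPrimitiveRoot_exp r hrpos.ne'
  set z := Complex.exp (2 * Real.pi * Complex.I / r)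
  set u := (1 - (PowerSeries.X : PowerSeries ℂ) ^ r) ^ (m.1.parts.count r) with hu
  have hlow : ∀ i ∈ s.erase m, c i • (u * partitionSeries i.1) ∈ vanishSub z := by
    intro i hi
    rw [Finset.mem_erase] at hi
    by_cases hci : c i = 0
    · rw [hci, zero_smul]; exact Submodule.zero_mem _
    apply Submodule.smul_mem
    have hle := hmax i (by simp [hi.2, hci])
    have hlt : pkey i.1 < pkey m.1 :=
      lt_of_le_of_ne hle (fun h => hi.1 (Subtype.ext (hA i.2 m.2 h)))
    rw [pkey, pkey, Prod.Lex.toLex_lt_toLex] at hlt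
    rcases hlt with h | ⟨h, h'⟩
    · apply low_mem _ _ _ _ hz h.le
      rw [Multiset.count_eq_zero_of_notMem]
      · exact hcpos
      · intro hmem
        exact absurd (Multiset.le_sup hmem) (not_le.mpr h)
    · simp only at h h'
      apply low_mem _ _ _ _ hz h.le
      rw [h] at h'
      exact h'
  have hs2 : ∑ i ∈ s, c i • (u * partitionSeries i.1) = 0 := by
    have : ∑ i ∈ s, c i • (u * partitionSeries i.1) = u * ∑ i ∈ s, c i • partitionSeries i.1 := by
      rw [Finset.mul_sum]
      exact Finset.sum_congr rfl (fun i _ => (mul_smul_comm _ _ _).symm)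
    rw [this, hsum, mul_zero]
  rw [← Finset.add_sum_erase _ _ hm.1] at hs2
  have h3 := Submodule.sum_mem _ hlow
  have h4 : c m • (u * partitionSeries m.1) ∈ vanishSub z := by
    rw [eq_neg_of_add_eq_zero_left hs2]
    exact Submodule.neg_mem _ h3
  exact top_not_mem m.1 r z hz le_rfl ((Submodule.smul_mem_iff _ hm.2).mp h4)

lemma A_form {p n : ℕ} (hn : 0 < n) (lam : Nat.Partition n) (h : lam ∈ Apartitions p n) :
    lam.parts = Multiset.replicate (lam.parts.count lam.parts.sup) lam.parts.sup +
      Multiset.replicate (n - lam.parts.count lam.parts.sup * lam.parts.sup) 1 := by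
  obtain ⟨r, a, b, hr, -, he⟩ := h
  have hsum := lam.parts_sum
  have aux : ∀ k : ℕ, k ≠ 0 → ∀ x : ℕ, (Multiset.replicate k x).sup = x := by
    intro k hk x
    apply le_antisymm
    · exact Multiset.sup_le.mpr (fun y hy => (Multiset.eq_of_mem_replicate hy).le)
    · exact Multiset.le_sup (Multiset.mem_replicate.mpr ⟨hk, rfl⟩)
  by_cases hc : a = 0 ∨ r = 1
  · have he' : lam.parts = Multiset.replicate n 1 := by
      have : lam.parts = Multiset.replicate (a + b) 1 := by
        rcases hc with rfl | rfl
        · simpa using he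
        · rw [he, Multiset.replicate_add]
      rw [this] at hsum ⊢
      simp at hsum
      rw [hsum]
    rw [he', aux n hn.ne']
    simp
  · push Not at hc
    have hs : lam.parts.sup = r := by
      rw [he, Multiset.sup_add, aux a hc.1]
      apply sup_eq_left.mpr
      exact Multiset.sup_le.mpr (fun y hy => (Multiset.eq_of_mem_replicate hy).le.trans hr)
    have hcount : lam.parts.count r = a := by
      rw [he, Multiset.count_add, Multiset.count_replicate_self, Multiset.count_replicate]
      simp [hc.2.symm]
    rw [hs, hcount]
    rw [he] at hsum
    simp at hsum
    have : n - a * r = b := by omega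
    rw [this, he]

/-- The set `{f_λ : λ ∈ A_{p,n}}` is linearly independent over `ℂ`;
consequently `B(p,n) ≥ |A_{p,n}|`. -/
theorem stmt_13 (p n : ℕ) (hp : p.Prime) (hn : 0 < n) :
    LinearIndependent ℂ (fun lam : Apartitions p n => partitionSeries lam.1) ∧
    (Apartitions p n).ncard ≤
      Module.finrank ℂ (Submodule.span ℂ (partitionSeries '' XPartitions p n)) := by
  classical
  have hli : LinearIndependent ℂ (fun lam : Apartitions p n => partitionSeries lam.1) := by
    apply linInd hn
    intro x hx y hy hxy
    have h1 := A_form hn x hx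
    have h2 := A_form hn y hy
    have h3 : x.parts.sup = y.parts.sup := congrArg (fun q => (ofLex q).1) hxy
    have h4 : x.parts.count x.parts.sup = y.parts.count y.parts.sup :=
      congrArg (fun q => (ofLex q).2) hxy
    apply Nat.Partition.ext
    rw [h1, h2, h4, h3]
  refine ⟨hli, ?_⟩
  have hfin : (partitionSeries '' XPartitions p n).Finite := (Set.toFinite _).image _
  haveI := FiniteDimensional.span_of_finite ℂ hfin
  haveI : Fintype (Apartitions p n) := Fintype.ofFinite _
  rw [← Nat.card_coe_set_eq, Nat.card_eq_fintype_card, ← finrank_span_eq_card hli]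
  apply Submodule.finrank_mono
  apply Submodule.span_mono
  rintro _ ⟨⟨lam, r, a, b, hr, hrp, he⟩, rfl⟩
  refine ⟨lam, ?_, rfl⟩
  intro j hj
  rw [he, Multiset.mem_add] at hj
  rcases hj with hj | hj
  · rw [Multiset.eq_of_mem_replicate hj]; exact hrp
  · rw [Multiset.eq_of_mem_replicate hj]; exact Nat.coprime_one_left p
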